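/- There is no Artinian Gorenstein graded quotient R/I of R = k[x_1,...,x_5], over a field k of characteristic 2, with Hilbert function (1,5,5,1) whose graded minimal free resolution is pure with Betti numbers (1; 10, 16; 16, 10; 1), i.e., with β_{2,3} = β_{3,5} = 16 and no other Betti numbers in those columns. -/

import Mathlib

open MvPolynomial

attribute [local instance] MvPolynomial.gradedAlgebra

variable {k : Type*} [Field k]


/-- The contragredient scalar action `(r • f) m = f (r • m)`. -/
noncomputable def contraSMul {R M : Type*} [CommRing R] [Algebra k R]
    [AddCommGroup M] [Module k M] [Module R M] [IsScalarTower k R M]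
    (r : R) (f : M →ₗ[k] k) : M →ₗ[k] k where
  toFun m := f (r • m)
  map_add' a b := by
    show f (r • (a + b)) = f (r • a) + f (r • b)
    rw [smul_add, map_add]
  map_smul' c a := by
    show f (r • c • a) = c • f (r • a)
    rw [smul_comm r c a, map_smul]

/-- The contragredient `R`-module structure on the `k`-linear dual of an `R`-module `M`. -/
noncomputable instance contragredientModule
    {R M : Type*} [CommRing R] [Algebra k R]
    [AddCommGroup M] [Module k M] [Module R M] [IsScalarTower k R M] :
    Module R (M →ₗ[k] k) where
  smul := contraSMul
  one_smul f := LinearMap.ext fun m => by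
    show f ((1 : R) • m) = f m
    rw [one_smul]
  mul_smul r s f := LinearMap.ext fun m => by
    show f ((r * s) • m) = f (s • r • m)
    rw [mul_comm, mul_smul]
  smul_zero r := LinearMap.ext fun m => by
    show (0 : M →ₗ[k] k) (r • m) = 0
    simp
  smul_add r f g := LinearMap.ext fun m => by
    show (f + g) (r • m) = f (r • m) + g (r • m)
    simp
  add_smul r s f := LinearMap.ext fun m => by
    show f ((r + s) • m) = f (r • m) + f (s • m)
    rw [add_smul, map_add]
  zero_smul f := LinearMap.ext fun m => by
    show f ((0 : R) • m) = 0
    rw [zero_smul, map_zero]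

theorem sum_symm_eq_zero {A ι : Type*} [CommRing A] [CharP A 2] [Fintype ι] [DecidableEq ι]
    (f : ι → ι → A) (hs : ∀ a b, f a b = f b a) (h0 : ∀ a, f a a = 0) :
    ∑ a, ∑ b, f a b = 0 := by
  rw [← Fintype.sum_prod_type']
  refine Finset.sum_involution (fun p _ => p.swap) ?_ ?_ ?_ ?_
  · rintro ⟨a, b⟩ _
    simp only [Prod.swap]
    rw [hs a b]
    exact CharTwo.add_self_eq_zero _
  · rintro ⟨a, b⟩ _ h e
    simp only [Prod.swap, Prod.mk.injEq] at e
    apply h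
    simp only
    rw [e.1, h0]
  · simp
  · simp

theorem det_alt_odd {A ι : Type*} [CommRing A] [CharP A 2] [Fintype ι] [DecidableEq ι]
    (M : Matrix ι ι A) (hs : ∀ a b, M a b = M b a) (h0 : ∀ a, M a a = 0)
    (hodd : ¬ 2 ∣ Fintype.card ι) : M.det = 0 := by
  rw [Matrix.det_apply]
  refine Finset.sum_involution (fun σ _ => σ⁻¹) ?_ ?_ ?_ ?_
  · intro σ _
    have : ∏ i, M (σ⁻¹ i) i = ∏ i, M (σ i) i := by
      rw [← Equiv.prod_comp σ]
      refine Finset.prod_congr rfl fun i _ => ?_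
      simp [hs]
    rw [this, Equiv.Perm.sign_inv]
    exact CharTwo.add_self_eq_zero _
  · intro σ _ h e
    apply h
    have h2 : σ ^ 2 ^ 1 = 1 := by
      simp only [pow_one, pow_two]
      nth_rw 1 [← e]
      simp
    obtain ⟨a, ha⟩ := Equiv.Perm.exists_fixed_point_of_prime hodd h2
    rw [Finset.prod_eq_zero (Finset.mem_univ a), smul_zero]
    rw [ha, h0]
  · simp
  · simp

/-- index set : pairs `(S, j)`, `|S| = 3`, where `j` does not dominate `S`. -/
abbrev GoodIdx : Type :=
  {p : Finset (Fin 5) × Fin 5 // p.1.card = 3 ∧ ¬ ∀ i ∈ p.1, i < p.2}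

theorem card_goodIdx : Fintype.card GoodIdx = 45 := by
  decide +kernel

theorem inter_iff (S : Finset (Fin 5)) (a b i : Fin 5) (hab : a ≠ b) (hS : S.card = 3) :
    S ∩ {a, b}ᶜ = {i} ↔ S = {a, b, i} := by
  revert S a b i
  decide +kernel

theorem compl_card (a b : Fin 5) (hab : a ≠ b) : ({a, b}ᶜ : Finset (Fin 5)).card = 3 := by
  revert a b; decide

theorem tri_card (a b : Fin 5) : ({a, a, b} : Finset (Fin 5)).card ≠ 3 := by
  revert a b; decide

theorem tri_card' (a b : Fin 5) : ({a, b, b} : Finset (Fin 5)).card ≠ 3 := by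
  revert a b; decide

theorem tri_swap (a b c : Fin 5) : ({a, b, c} : Finset (Fin 5)) = {a, c, b} := by
  revert a b c; decide

theorem removed_facts (a b l : Fin 5) (hab : a ≠ b)
    (h : ∀ i ∈ ({a, b}ᶜ : Finset (Fin 5)), i < l) : a = l ∨ b = l := by
  revert a b l; decide

theorem removed_facts' (a b l : Fin 5) (hab : a ≠ b) (hal : a ≠ l) (hbl : b ≠ l)
    (h : ∀ i ∈ ({a, l}ᶜ : Finset (Fin 5)), i < l) :
    ¬ ∀ i ∈ ({a, b}ᶜ : Finset (Fin 5)), i < b := by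
  revert a b l; decide

theorem exists_kernel [CharP k 2] (g : Fin 5 → Fin 5 → Fin 5 → k)
    (g1 : ∀ i j l, g i j l = g l j i) (g2 : ∀ i j l, g i j l = g i l j) :
    ∃ z : Finset (Fin 5) → Fin 5 → k, (∃ S j, z S j ≠ 0) ∧
      (∀ S j, S.card ≠ 3 → z S j = 0) ∧
      (∀ S j, (∀ i ∈ S, i < j) → z S j = 0) ∧
      ∀ a b l, ∑ i, ∑ j, z {a, b, i} j * g i j l = 0 := by
  let M : Matrix GoodIdx GoodIdx k := fun p q =>
    ∑ i, if q.1.1 ∩ p.1.1 = {i} then g i q.1.2 p.1.2 else 0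
  have hdet : M.det = 0 := by
    apply det_alt_odd
    · intro p q
      simp only [M]
      refine Finset.sum_congr rfl fun i _ => ?_
      rw [Finset.inter_comm, g2]
    · intro p
      simp only [M]
      refine Finset.sum_eq_zero fun i _ => ?_
      rw [if_neg]
      intro h
      have := p.2.1
      rw [Finset.inter_self] at h
      rw [h] at this
      simp at this
    · rw [card_goodIdx]; norm_num
  obtain ⟨y, hy0, hy⟩ := Matrix.exists_mulVec_eq_zero_iff.2 hdet
  let z : Finset (Fin 5) → Fin 5 → k := fun S j =>
    if h : S.card = 3 ∧ ¬ ∀ i ∈ S, i < j then y ⟨(S, j), h⟩ else 0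
  have z1 : ∀ S j, S.card ≠ 3 → z S j = 0 := fun S j h => dif_neg fun h' => h h'.1
  have z2 : ∀ S j, (∀ i ∈ S, i < j) → z S j = 0 := fun S j h => dif_neg fun h' => h'.2 h
  have zy : ∀ p : GoodIdx, z p.1.1 p.1.2 = y p := fun p => dif_pos p.2
  refine ⟨z, ?_, z1, z2, ?_⟩
  · obtain ⟨p, hp⟩ := Function.ne_iff.1 hy0
    exact ⟨p.1.1, p.1.2, by rw [zy]; exact hp⟩
  -- vanishing on the good rows
  have good : ∀ a b l, a ≠ b → (¬ ∀ i ∈ ({a, b}ᶜ : Finset (Fin 5)), i < l) →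
      ∑ i, ∑ j, z {a, b, i} j * g i j l = 0 := by
    intro a b l hab hl
    have h1 := congrFun hy ⟨({a, b}ᶜ, l), compl_card a b hab, hl⟩
    simp only [Matrix.mulVec, dotProduct, M, Pi.zero_apply] at h1
    have h2 : ∑ p : Finset (Fin 5) × Fin 5,
        (∑ i, if p.1 ∩ {a, b}ᶜ = {i} then g i p.2 l else 0) * z p.1 p.2 = 0 := by
      refine Eq.trans ?_ h1
      simp_rw [← zy]
      symm
      refine Finset.sum_of_injOn (fun p : GoodIdx => p.1) (Subtype.val_injective.injOn)
        (by simp) ?_ ?_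
      · intro p _ hp
        have : z p.1 p.2 = 0 := dif_neg fun h => hp ⟨⟨p, h⟩, by simp⟩
        rw [this, mul_zero]
      · intro p _
        rfl
    refine Eq.trans ?_ h2
    rw [Fintype.sum_prod_type]
    simp_rw [Finset.sum_mul]
    rw [Finset.sum_comm, Finset.sum_comm (s := (Finset.univ : Finset (Finset (Fin 5))))]
    refine Finset.sum_congr rfl fun j _ => ?_
    rw [Finset.sum_comm (s := (Finset.univ : Finset (Finset (Fin 5))))]
    refine Finset.sum_congr rfl fun i _ => ?_
    rw [Finset.sum_eq_single ({a, b, i} : Finset (Fin 5))]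
    · by_cases hc : ({a, b, i} : Finset (Fin 5)).card = 3
      · rw [if_pos ((inter_iff _ a b i hab hc).2 rfl), mul_comm]
      · rw [z1 _ _ hc]; simp
    · intro S _ hS
      by_cases hc : S.card = 3
      · rw [if_neg (fun h => hS ((inter_iff _ a b i hab hc).1 h)), zero_mul]
      · rw [z1 _ _ hc]; simp
    · simp
  have diag : ∀ a l, ∑ i, ∑ j, z {a, a, i} j * g i j l = 0 := by
    intro a l
    refine Finset.sum_eq_zero fun i _ => Finset.sum_eq_zero fun j _ => ?_
    rw [z1 _ _ (tri_card a i), zero_mul]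
  have tot : ∀ a, ∑ b, ∑ i, ∑ j, z {a, b, i} j * g i j b = 0 := by
    intro a
    apply sum_symm_eq_zero
    · intro b i
      refine Finset.sum_congr rfl fun j _ => ?_
      rw [tri_swap, g1]
    · intro b
      refine Finset.sum_eq_zero fun j _ => ?_
      rw [z1 _ _ (tri_card' a b), zero_mul]
  have bad : ∀ a l, a ≠ l → (∀ i ∈ ({a, l}ᶜ : Finset (Fin 5)), i < l) →
      ∑ i, ∑ j, z {a, l, i} j * g i j l = 0 := by
    intro a l hal h
    have := tot a
    rw [Finset.sum_eq_single l] at this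
    · exact this
    · intro b _ hb
      by_cases hab : a = b
      · subst hab; exact diag _ _
      · exact good a b b hab (removed_facts' a b l hab hal hb h)
    · simp
  intro a b l
  by_cases hab : a = b
  · subst hab; exact diag _ _
  by_cases hl : ∀ i ∈ ({a, b}ᶜ : Finset (Fin 5)), i < l
  · rcases removed_facts a b l hab hl with h | h
    · subst h
      have := bad b a (Ne.symm hab) (by rwa [Finset.pair_comm])
      simpa only [Finset.insert_comm b a] using this
    · subst h
      exact bad a b hab hl
  · exact good a b l hab hl

theorem tri_exists (S : Finset (Fin 5)) (j : Fin 5) (hS : S.card = 3) :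
    (∃ a b, S = {a, b, j}) ∨ (∀ i ∈ S, i < j) ∨
      ∃ a b i, i ≠ j ∧ S = {a, b, i} ∧ ∀ c ∈ ({a, b, j} : Finset (Fin 5)), c < i := by
  revert S j; decide +kernel

theorem z_zero (z : Finset (Fin 5) → Fin 5 → k)
    (z1 : ∀ S j, S.card ≠ 3 → z S j = 0)
    (z2 : ∀ S j, (∀ i ∈ S, i < j) → z S j = 0)
    (h1 : ∀ a b i, z {a, b, i} i = 0)
    (h2 : ∀ a b i j, i ≠ j → z {a, b, i} j + z {a, b, j} i = 0) (S j) : z S j = 0 := by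
  by_cases hS : S.card = 3
  · rcases tri_exists S j hS with ⟨a, b, rfl⟩ | h | ⟨a, b, i, hij, rfl, h⟩
    · exact h1 a b j
    · exact z2 _ _ h
    · have := h2 a b i j hij
      rwa [z2 _ _ h, add_zero] at this
  · exact z1 _ _ hS

theorem hc_mul {d e : ℕ} {a b : MvPolynomial (Fin 5) k} (ha : a.IsHomogeneous d) :
    homogeneousComponent (d + e) (a * b) = a * homogeneousComponent e b := by
  have := DirectSum.coe_decompose_mul_add_of_left_mem (homogeneousSubmodule (Fin 5) k)
    (j := e) (b := b) (a_mem := (mem_homogeneousSubmodule d a).2 ha)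
  rw [← decomposition.decompose'_apply, ← decomposition.decompose'_apply]
  exact this

theorem hc_mul_lt {d n : ℕ} {a b : MvPolynomial (Fin 5) k} (ha : a.IsHomogeneous d) (h : n < d) :
    homogeneousComponent n (a * b) = 0 := by
  have := DirectSum.coe_decompose_mul_of_left_mem_of_not_le (homogeneousSubmodule (Fin 5) k)
    (n := n) (b := b) (a_mem := (mem_homogeneousSubmodule d a).2 ha) (by omega)
  rw [← decomposition.decompose'_apply]
  exact this

theorem hc_self {n : ℕ} {a : MvPolynomial (Fin 5) k} (ha : a.IsHomogeneous n) :
    homogeneousComponent n a = a :=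
  homogeneousComponent_eq_self ha

theorem mulVec_hc {m n d e : ℕ} {M : Matrix (Fin m) (Fin n) (MvPolynomial (Fin 5) k)}
    (hM : ∀ i j, (M i j).IsHomogeneous d) {v : Fin m → MvPolynomial (Fin 5) k}
    (hv : ∀ i, (v i).IsHomogeneous (d + e)) {w : Fin n → MvPolynomial (Fin 5) k}
    (h : M.mulVec w = v) : M.mulVec (fun j => homogeneousComponent e (w j)) = v := by
  subst h
  funext i
  have := hc_self (hv i)
  rw [← this]
  simp only [Matrix.mulVec, dotProduct, map_sum]
  exact Finset.sum_congr rfl fun j _ => (hc_mul (hM i j)).symm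

theorem mulVec_hc_lt {m n d e : ℕ} {M : Matrix (Fin m) (Fin n) (MvPolynomial (Fin 5) k)}
    (hM : ∀ i j, (M i j).IsHomogeneous d) {v : Fin m → MvPolynomial (Fin 5) k}
    (hv : ∀ i, (v i).IsHomogeneous e) (hed : e < d) {w : Fin n → MvPolynomial (Fin 5) k}
    (h : M.mulVec w = v) : v = 0 := by
  subst h
  funext i
  have := hc_self (hv i)
  rw [← this]
  simp only [Matrix.mulVec, dotProduct, map_sum]
  exact Finset.sum_eq_zero fun j _ => hc_mul_lt (hM i j) hed

theorem lin_zero (c : Fin 5 → k) (h : ∑ b, X b * C (c b) = (0 : MvPolynomial (Fin 5) k))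
    (b : Fin 5) : c b = 0 := by
  have := congrArg (eval (Pi.single b (1 : k))) h
  simpa [Pi.single_apply] using this

theorem quad_zero (c : Fin 5 → Fin 5 → k)
    (h : ∑ i, X i * ∑ j, X j * C (c i j) = (0 : MvPolynomial (Fin 5) k)) :
    (∀ i, c i i = 0) ∧ ∀ i j, i ≠ j → c i j + c j i = 0 := by
  have h1 : ∀ i, c i i = 0 := by
    intro i
    have := congrArg (eval (Pi.single i (1 : k))) h
    simpa [Pi.single_apply] using this
  refine ⟨h1, fun i j hij => ?_⟩
  have := congrArg (eval (Pi.single i (1 : k) + Pi.single j 1)) h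
  rw [add_comm]
  simpa [Pi.single_apply, add_mul, mul_add, Finset.sum_add_distrib, h1] using this

theorem res_part [CharP k 2]
    (A1 : Matrix (Fin 1) (Fin 10) (MvPolynomial (Fin 5) k))
    (A2 : Matrix (Fin 10) (Fin 16) (MvPolynomial (Fin 5) k))
    (A3 : Matrix (Fin 16) (Fin 16) (MvPolynomial (Fin 5) k))
    (d2 : ∀ i j, (A2 i j).IsHomogeneous 1)
    (d3 : ∀ i j, (A3 i j).IsHomogeneous 2)
    (e1 : ∀ v, A1.mulVec v = 0 → ∃ w, A2.mulVec w = v)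
    (e2 : ∀ v, A2.mulVec v = 0 → ∃ w, A3.mulVec w = v)
    (q : Fin 5 → Fin 5 → MvPolynomial (Fin 5) k)
    (qs : ∀ a b, q a b = q b a) (q0 : ∀ a, q a a = 0) (qX : ∀ a, ∑ b, X b * q a b = 0)
    (hc : ∀ a b, ∃ c : Fin 10 → k, A1.mulVec (fun m => C (c m)) = fun _ => q a b) (a b) :
    q a b = 0 := by
  have uniq : ∀ c : Fin 10 → k, A1.mulVec (fun m => C (c m)) = 0 → c = 0 := by
    intro c h
    obtain ⟨w, hw⟩ := e1 _ h
    have := mulVec_hc_lt d2 (e := 0) (fun i => isHomogeneous_C _ _) (by norm_num) hw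
    funext m
    simpa using congrFun this m
  choose c hc using hc
  have cs : ∀ a b, c a b = c b a := by
    intro a b
    rw [← sub_eq_zero]
    apply uniq
    have : (fun m => C ((c a b - c b a) m)) = (fun m => (C (c a b m) : MvPolynomial (Fin 5) k))
        - fun m => C (c b a m) := by
      funext m; simp
    rw [this, Matrix.mulVec_sub, hc, hc, qs, sub_self]
  have c0 : ∀ a, c a a = 0 := by
    intro a
    apply uniq
    rw [hc, q0]; rfl
  have lin : ∀ a, ∃ t : Fin 16 → k, A2.mulVec (fun m => C (t m)) =
      fun m => ∑ b, X b * C (c a b m) := by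
    intro a
    have h : A1.mulVec (fun m => ∑ b, X b * C (c a b m)) = 0 := by
      funext i
      rw [Pi.zero_apply, ← qX a]
      have : ∀ b, q a b = ∑ m, A1 i m * C (c a b m) := fun b => (congrFun (hc a b) i).symm
      simp only [Matrix.mulVec, dotProduct, this, Finset.mul_sum]
      rw [Finset.sum_comm]
      refine Finset.sum_congr rfl fun b _ => Finset.sum_congr rfl fun m _ => ?_
      ring
    obtain ⟨w, hw⟩ := e1 _ h
    have := mulVec_hc d2 (e := 0) (fun i => IsHomogeneous.sum _ _ _ fun b _ =>
      (isHomogeneous_X k b).mul (isHomogeneous_C _ _)) hw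
    simp only [homogeneousComponent_zero] at this
    exact ⟨_, this⟩
  choose t ht using lin
  have h2 : A2.mulVec (fun m => ∑ a, X a * C (t a m)) = 0 := by
    funext i
    have h3 : ∀ a, ∑ m, A2 i m * C (t a m) = ∑ b, X b * C (c a b i) := fun a => congrFun (ht a) i
    have h4 : ∑ a, ∑ b, X a * (X b * C (c a b i)) = (0 : MvPolynomial (Fin 5) k) := by
      apply sum_symm_eq_zero
      · intro a b
        rw [cs]; ring
      · intro a; rw [c0]; simp
    rw [Pi.zero_apply, ← h4]
    simp only [← Finset.mul_sum, ← h3]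
    simp only [Matrix.mulVec, dotProduct, Finset.mul_sum]
    rw [Finset.sum_comm]
    refine Finset.sum_congr rfl fun b _ => Finset.sum_congr rfl fun m _ => ?_
    ring
  obtain ⟨w, hw⟩ := e2 _ h2
  have h5 := mulVec_hc_lt d3 (fun i => IsHomogeneous.sum _ _ _ fun b _ =>
      (isHomogeneous_X k b).mul (isHomogeneous_C _ _)) (by norm_num) hw
  have t0 : ∀ a m, t a m = 0 := fun a m => lin_zero (fun a => t a m) (congrFun h5 m) a
  have cz : ∀ a b m, c a b m = 0 := by
    intro a b m
    refine lin_zero (fun b => c a b m) ?_ b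
    have := congrFun (ht a) m
    rw [← this]
    simp [Matrix.mulVec, dotProduct, t0]
  have := congrFun (hc a b) 0
  rw [← this]
  simp [Matrix.mulVec, dotProduct, cz]

theorem gor_part (I : Ideal (MvPolynomial (Fin 5) k))
    (hI : I.IsHomogeneous (homogeneousSubmodule (Fin 5) k))
    (h3 : Module.finrank k ((homogeneousSubmodule (Fin 5) k 3).map
              ((Ideal.Quotient.mkₐ k I).toLinearMap)) = 1)
    (hfd : FiniteDimensional k (MvPolynomial (Fin 5) k ⧸ I))
    (h4 : Module.finrank k ((homogeneousSubmodule (Fin 5) k 4).map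
              ((Ideal.Quotient.mkₐ k I).toLinearMap)) = 0)
    (τ : (MvPolynomial (Fin 5) k ⧸ I) ≃ₗ[MvPolynomial (Fin 5) k]
          ((MvPolynomial (Fin 5) k ⧸ I) →ₗ[k] k))
    (q : MvPolynomial (Fin 5) k) (hq : q.IsHomogeneous 2)
    (hX : ∀ l, τ (Ideal.Quotient.mk I 1) (Ideal.Quotient.mk I (q * X l)) = 0) : q ∈ I := by
  have hτ : ∀ a b : MvPolynomial (Fin 5) k, τ (Ideal.Quotient.mk I a) (Ideal.Quotient.mk I b) =
      τ (Ideal.Quotient.mk I 1) (Ideal.Quotient.mk I (a * b)) := by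
    intro a b
    have h1 : Ideal.Quotient.mk I a = a • Ideal.Quotient.mk I 1 := by
      have h2 : a • Ideal.Quotient.mk I 1 = Ideal.Quotient.mk I (a * 1) := rfl
      rw [h2, mul_one]
    rw [h1, map_smul]
    rfl
  have hC : ∀ (c : k) (a : MvPolynomial (Fin 5) k),
      τ (Ideal.Quotient.mk I 1) (Ideal.Quotient.mk I (C c * a)) =
      c * τ (Ideal.Quotient.mk I 1) (Ideal.Quotient.mk I a) := by
    intro c a
    have : Ideal.Quotient.mk I (C c * a) = c • Ideal.Quotient.mk I a := by
      rw [← MvPolynomial.smul_eq_C_mul]; rfl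
    rw [this, map_smul, smul_eq_mul]
  have soc : ∀ a : MvPolynomial (Fin 5) k, (∀ l, a * X l ∈ I) → ∀ b,
      Ideal.Quotient.mk I (a * b) = Ideal.Quotient.mk I (C (constantCoeff b) * a) := by
    intro a ha b
    induction b using MvPolynomial.induction_on with
    | C c => simp [mul_comm]
    | add p r hp hr =>
      rw [mul_add, map_add, hp, hr, ← map_add, ← add_mul, ← C_add, ← map_add]
    | mul_X p l hp =>
      rw [map_mul constantCoeff, constantCoeff_X, mul_zero, C_0, zero_mul, map_zero,
        Ideal.Quotient.eq_zero_iff_mem]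
      have : a * (p * X l) = p * (a * X l) := by ring
      rw [this]
      exact I.mul_mem_left _ (ha l)
  have hR4 : ∀ p : MvPolynomial (Fin 5) k, p.IsHomogeneous 4 → p ∈ I := by
    intro p hp
    have := Submodule.finrank_eq_zero.1 h4
    have h : (Ideal.Quotient.mkₐ k I).toLinearMap p ∈ (⊥ : Submodule k _) := by
      rw [← this]
      exact Submodule.mem_map_of_mem hp
    exact Ideal.Quotient.eq_zero_iff_mem.1 ((Submodule.mem_bot k).1 h)
  obtain ⟨⟨v, hv⟩, hv0, hspan⟩ := finrank_eq_one_iff'.1 h3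
  obtain ⟨a, ha, hav⟩ := hv
  have hav' : Ideal.Quotient.mk I a = v := hav
  have ha' : a.IsHomogeneous 3 := ha
  have haI : a ∉ I := by
    intro h
    apply hv0
    apply Subtype.ext
    exact hav'.symm.trans (Ideal.Quotient.eq_zero_iff_mem.2 h)
  have haX : ∀ l, a * X l ∈ I := fun l => hR4 _ (ha'.mul (isHomogeneous_X k l))
  have hφa : τ (Ideal.Quotient.mk I 1) (Ideal.Quotient.mk I a) ≠ 0 := by
    intro h
    apply haI
    rw [← Ideal.Quotient.eq_zero_iff_mem]
    apply τ.injective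
    rw [map_zero]
    refine LinearMap.ext fun b => ?_
    obtain ⟨b, rfl⟩ := Ideal.Quotient.mk_surjective b
    rw [hτ, soc a haX, hC, h, mul_zero]
    rfl
  have hqX : ∀ l, q * X l ∈ I := by
    intro l
    have hmem : Ideal.Quotient.mk I (q * X l) ∈ (homogeneousSubmodule (Fin 5) k 3).map
              ((Ideal.Quotient.mkₐ k I).toLinearMap) :=
      Submodule.mem_map_of_mem (f := (Ideal.Quotient.mkₐ k I).toLinearMap)
        ((mem_homogeneousSubmodule _ _).2 (hq.mul (isHomogeneous_X k l)))
    obtain ⟨c, hc⟩ := hspan ⟨_, hmem⟩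
    have hc' : c • v = Ideal.Quotient.mk I (q * X l) := congrArg Subtype.val hc
    have := hX l
    rw [← hc', ← hav', map_smul, smul_eq_mul] at this
    rcases mul_eq_zero.1 this with h | h
    · rw [← Ideal.Quotient.eq_zero_iff_mem, ← hc', h, zero_smul]
    · exact absurd h hφa
  set lam := τ (Ideal.Quotient.mk I 1) (Ideal.Quotient.mk I q) /
    τ (Ideal.Quotient.mk I 1) (Ideal.Quotient.mk I a) with hlam
  have heq : Ideal.Quotient.mk I q = Ideal.Quotient.mk I (C lam * a) := by
    apply τ.injective
    refine LinearMap.ext fun b => ?_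
    obtain ⟨b, rfl⟩ := Ideal.Quotient.mk_surjective b
    rw [hτ q, soc q hqX, hC, hτ (C lam * a), mul_assoc, hC, soc a haX, hC, hlam]
    field_simp
  have hmem : q - C lam * a ∈ I := (Ideal.Quotient.mk_eq_mk_iff_sub_mem _ _).1 heq
  have := homogeneousComponent_mem_of_mem hI hmem 2
  rw [map_sub, hc_self hq, homogeneousComponent_of_mem (n := 3) (ha'.C_mul lam)] at this
  simpa using this

/-- Over a field of characteristic 2 there is no Artinian Gorenstein
graded quotient `R/I` of `R = k[x_1,…,x_5]` with Hilbert function `(1,5,5,1)`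
whose graded minimal free resolution is pure with Betti table
`(1; 10, 16; 16, 10; 1)`, i.e. of the shape
`0 ← R/I ← R ← R(-2)^10 ← R(-3)^16 ← R(-5)^16 ← R(-6)^10 ← R(-8) ← 0`. -/
theorem no_pure_gorenstein_resolution_char_two
    (hchar : ringChar k = 2) :
    ¬ ∃ (I : Ideal (MvPolynomial (Fin 5) k))
        (_ : I.IsHomogeneous (homogeneousSubmodule (Fin 5) k))
        -- Artinian of Hilbert function (1,5,5,1):
        (_ : FiniteDimensional k (MvPolynomial (Fin 5) k ⧸ I))
        (_ : ∀ j : ℕ,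
          Module.finrank k
            ((homogeneousSubmodule (Fin 5) k j).map
              ((Ideal.Quotient.mkₐ k I).toLinearMap)) =
            if j = 0 then 1 else if j = 1 then 5 else if j = 2 then 5 else
              if j = 3 then 1 else 0)
        -- Gorenstein, via a self-adjoint duality τ:
        (τ : (MvPolynomial (Fin 5) k ⧸ I) ≃ₗ[MvPolynomial (Fin 5) k]
          ((MvPolynomial (Fin 5) k ⧸ I) →ₗ[k] k))
        (_ : ∀ a b : MvPolynomial (Fin 5) k ⧸ I, τ a b = τ b a)
        -- a pure minimal graded free resolution with Betti numbers 1,10,16,16,10,1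
        -- and degree sequence (0,2,3,5,6,8):
        (A1 : Matrix (Fin 1) (Fin 10) (MvPolynomial (Fin 5) k))
        (A2 : Matrix (Fin 10) (Fin 16) (MvPolynomial (Fin 5) k))
        (A3 : Matrix (Fin 16) (Fin 16) (MvPolynomial (Fin 5) k))
        (A4 : Matrix (Fin 16) (Fin 10) (MvPolynomial (Fin 5) k))
        (A5 : Matrix (Fin 10) (Fin 1) (MvPolynomial (Fin 5) k))
        (_ : ∀ i j, (A1 i j).IsHomogeneous 2)
        (_ : ∀ i j, (A2 i j).IsHomogeneous 1)
        (_ : ∀ i j, (A3 i j).IsHomogeneous 2)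
        (_ : ∀ i j, (A4 i j).IsHomogeneous 1)
        (_ : ∀ i j, (A5 i j).IsHomogeneous 2),
      Function.Surjective
          (Submodule.mkQ I ∘ₗ (LinearMap.proj (R := MvPolynomial (Fin 5) k)
            (φ := fun _ : Fin 1 => MvPolynomial (Fin 5) k) 0)) ∧
        Function.Exact (Matrix.toLin' A1)
          (Submodule.mkQ I ∘ₗ (LinearMap.proj (R := MvPolynomial (Fin 5) k)
            (φ := fun _ : Fin 1 => MvPolynomial (Fin 5) k) 0)) ∧
        Function.Exact (Matrix.toLin' A2) (Matrix.toLin' A1) ∧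
        Function.Exact (Matrix.toLin' A3) (Matrix.toLin' A2) ∧
        Function.Exact (Matrix.toLin' A4) (Matrix.toLin' A3) ∧
        Function.Exact (Matrix.toLin' A5) (Matrix.toLin' A4) ∧
        Function.Injective (Matrix.toLin' A5) := by
  rintro ⟨I, hI, hfd, hH, τ, -, A1, A2, A3, A4, A5, d1, d2, d3, -, -, -, ex0, ex1, ex2, -⟩
  have : CharP k 2 := hchar ▸ ringChar.charP k
  let φ : MvPolynomial (Fin 5) k → k := fun p =>
    τ (Ideal.Quotient.mk I 1) (Ideal.Quotient.mk I p)
  have φsum : ∀ f : Fin 5 → MvPolynomial (Fin 5) k, φ (∑ i, f i) = ∑ i, φ (f i) := by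
    intro f
    simp only [φ, map_sum]
  have φC : ∀ (c : k) p, φ (C c * p) = c * φ p := by
    intro c a
    have : Ideal.Quotient.mk I (C c * a) = c • Ideal.Quotient.mk I a := by
      rw [← MvPolynomial.smul_eq_C_mul]; rfl
    simp only [φ]
    rw [this, map_smul, smul_eq_mul]
  obtain ⟨z, ⟨S, j, hz⟩, z1, z2, hker⟩ := exists_kernel (fun i j l => φ (X i * X j * X l))
    (fun i j l => by congr 1; ring) (fun i j l => by congr 1; ring)
  let q : Fin 5 → Fin 5 → MvPolynomial (Fin 5) k := fun a b =>
    ∑ i, X i * ∑ j, X j * C (z {a, b, i} j)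
  have qhom : ∀ a b, (q a b).IsHomogeneous 2 := fun a b =>
    IsHomogeneous.sum _ _ _ fun i _ => (isHomogeneous_X k i).mul
      (IsHomogeneous.sum _ _ _ fun j _ => (isHomogeneous_X k j).mul (isHomogeneous_C _ _))
  have qI : ∀ a b, q a b ∈ I := by
    intro a b
    refine gor_part I hI (by simpa using hH 3) hfd (by simpa using hH 4) τ _ (qhom a b) ?_
    intro l
    change φ (q a b * X l) = 0
    rw [← hker a b l]
    simp only [q, Finset.sum_mul, Finset.mul_sum, φsum]
    refine Finset.sum_congr rfl fun i _ => Finset.sum_congr rfl fun j _ => ?_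
    rw [← φC]
    congr 1
    ring
  have hqz : ∀ a b, q a b = 0 := by
    intro a b
    refine res_part A1 A2 A3 d2 d3 ?_ ?_ q ?_ ?_ ?_ ?_ a b
    · intro v hv
      exact (ex1 v).1 hv
    · intro v hv
      exact (ex2 v).1 hv
    · intro a b
      simp only [q, Finset.insert_comm a b]
    · intro a
      refine Finset.sum_eq_zero fun i _ => ?_
      rw [Finset.sum_eq_zero fun j _ => ?_, mul_zero]
      rw [z1 _ _ (tri_card a i), C_0, mul_zero]
    · intro a
      have h := sum_symm_eq_zero (fun b i => X b * (X i * ∑ j, X j * C (z {a, b, i} j)))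
        (fun b i => by simp only [tri_swap a b i]; ring)
        (fun b => by simp only [z1 _ _ (tri_card' a b), C_0, mul_zero, Finset.sum_const_zero])
      rw [← h]
      exact Finset.sum_congr rfl fun b _ => Finset.mul_sum _ _ _
    · intro a b
      obtain ⟨w, hw⟩ := (ex0 (fun _ => q a b)).1 ((Submodule.Quotient.mk_eq_zero I).2 (qI a b))
      have := mulVec_hc d1 (e := 0) (fun _ => qhom a b) hw
      simp only [homogeneousComponent_zero] at this
      exact ⟨_, this⟩
  exact hz (z_zero z z1 z2 (fun a b => (quad_zero _ (hqz a b)).1)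
    (fun a b => (quad_zero _ (hqz a b)).2) S j)
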